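/- arXiv:2101.11194 — 7 statements merged into one kernel-verified Lean document; each statement's English description precedes it below -/
import Mathlib

section
/- Let q be a prime power and n, r, t integers with 1 ≤ t < r ≤ n. Let G = (G′, G″) ∈ F_q^{n×(r−t)} × F_q^{n×t}, viewed as a single matrix G ∈ F_q^{n×r}. If the pair (G, id_{[n]}), with parameters (x, y, z) = (r−t, t, n), is an (r,t,n)-MMSP, then every r rows of G are linearly independent (i.e., the column space of G is an (n,r)-MDS code) and every t rows of G″ are linearly independent (i.e., the column space of G″ is an (n,t)-MDS code). -/
/-!
STATEMENT 0: If `(G, id)` with parameters `(x, y, z) = (r−t, t, n)` is an `(r,t,n)`-MMSP,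
then every `r` rows of `G` are linearly independent (`(n,r)`-MDS) and every `t` rows of
the last-`t`-columns submatrix `G″` are linearly independent (`(n,t)`-MDS).
Here we parametrize `x := r − t ≥ 1`, `y := t ≥ 1`, so `r = x + y`.
-/

theorem ker_funLeft_natAdd_le_span_single (F : Type*) [Field F] (x y : ℕ) :
    LinearMap.ker (LinearMap.funLeft F F (Fin.natAdd x : Fin y → Fin (x + y))) ≤
      Submodule.span F (Set.range fun i : Fin x =>
        (Pi.single (Fin.castAdd y i) 1 : Fin (x + y) → F)) := by
  intro v hv
  have hz (j : Fin y) : v (Fin.natAdd x j) = 0 := congrFun (LinearMap.mem_ker.mp hv) j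
  rw [pi_eq_sum_univ' v, Fin.sum_univ_add]
  simp only [hz, zero_smul, Finset.sum_const_zero, add_zero]
  refine Submodule.sum_mem _ fun i _ => Submodule.smul_mem _ _ (Submodule.subset_span ⟨i, ?_⟩)
  ext j
  simp [Pi.single_apply]

theorem spir_mmsp_implies_mds
    (F : Type*) [Field F] [Fintype F]
    (n x y : ℕ) (hx : 1 ≤ x) (hy : 1 ≤ y) (hn : x + y ≤ n)
    (G : Matrix (Fin n) (Fin (x + y)) F)
    -- the MMSP `(G, id)` accepts `𝔄 = {A ⊆ [n] : |A| ≥ r}` (with `r = x + y`):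
    (haccept : ∀ A : Finset (Fin n), x + y ≤ A.card → ∀ i : Fin x,
      (Pi.single (Fin.castAdd y i) 1 : Fin (x + y) → F) ∈
        Submodule.span F ((fun j => fun c => G j c) '' {j : Fin n | j ∈ A}))
    -- the MMSP `(G, id)` rejects `𝔅 = {B ⊆ [n] : |B| ≤ t}` (with `t = y`):
    (hreject : ∀ B : Finset (Fin n), B.card ≤ y →
      Submodule.span F
          (Set.range fun i : Fin x =>
            (Pi.single (Fin.castAdd y i) 1 : Fin (x + y) → F))
        ⊓ Submodule.span F ((fun j => fun c => G j c) '' {j : Fin n | j ∈ B}) = ⊥) :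
    -- every `r = x + y` rows of `G` are linearly independent:
    (∀ S : Finset (Fin n), S.card = x + y →
      LinearIndependent F (fun i : {a // a ∈ S} => fun c : Fin (x + y) => G i.1 c))
    ∧
    -- every `t = y` rows of `G″` are linearly independent:
    (∀ S : Finset (Fin n), S.card = y →
      LinearIndependent F (fun i : {a // a ∈ S} => fun c : Fin y => G i.1 (Fin.natAdd x c))) := by
  set E := Submodule.span F (Set.range fun i : Fin x =>
    (Pi.single (Fin.castAdd y i) 1 : Fin (x + y) → F)) with hE
  set π := LinearMap.funLeft F F (Fin.natAdd x : Fin y → Fin (x + y))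
  have hker : LinearMap.ker π ≤ E := ker_funLeft_natAdd_le_span_single F x y
  have hEne : E ≠ ⊥ := by
    intro h
    have h0 : (Pi.single (Fin.castAdd y ⟨0, hx⟩) 1 : Fin (x + y) → F) ∈ E :=
      Submodule.subset_span ⟨⟨0, hx⟩, rfl⟩
    rw [h, Submodule.mem_bot, Pi.single_eq_zero_iff] at h0
    exact one_ne_zero h0
  have hEle (A : Finset (Fin n)) (hA : x + y ≤ A.card) :
      E ≤ Submodule.span F ((fun j => fun c => G j c) '' {j : Fin n | j ∈ A}) := by
    rw [hE, Submodule.span_le]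
    rintro _ ⟨i, rfl⟩
    exact haccept A hA i
  have hproj (B : Finset (Fin n)) (hB : B.card ≤ y)
      (hli : LinearIndepOn F (fun j => fun c => G j c) {j : Fin n | j ∈ B}) :
      LinearIndepOn F (π ∘ fun j => fun c => G j c) {j : Fin n | j ∈ B} := by
    refine hli.map_injOn π (LinearMap.injOn_of_disjoint_ker subset_rfl ?_)
    exact (disjoint_iff.mpr (hreject B hB)).symm.mono_right hker
  have hfull (S : Finset (Fin n)) (hS : S.card = x + y) :
      LinearIndependent F (fun i : {a // a ∈ S} => fun c : Fin (x + y) => G i.1 c) := by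
    obtain ⟨b, hbS, -, hspan, hb⟩ := exists_linearIndepOn_extension
      (linearIndepOn_empty F (fun j => fun c => G j c)) (Set.empty_subset {j : Fin n | j ∈ S})
    lift b to Finset (Fin n) using Set.toFinite b
    have hEb : E ≤ Submodule.span F ((fun j => fun c => G j c) '' {j : Fin n | j ∈ b}) :=
      (hEle S hS.ge).trans (Submodule.span_le.mpr hspan)
    have hyb : y ≤ b.card := by
      by_contra! h
      exact hEne ((inf_eq_left.mpr hEb).symm.trans (hreject b h.le))
    obtain ⟨B, hBb, hB⟩ := Finset.exists_subset_card_eq hyb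
    have hπ := hproj B hB.le (hb.mono hBb)
    have htop := LinearIndependent.span_eq_top_of_card_eq_finrank' hπ (by simp [hB])
    apply linearIndependent_of_top_le_span_of_card_eq_finrank _ (by simp [hS])
    have hrange : Set.range (fun i : {a // a ∈ S} => fun c : Fin (x + y) => G i.1 c) =
        (fun j => fun c => G j c) '' {j : Fin n | j ∈ S} := by
      ext; simp
    rw [hrange]
    set W := Submodule.span F ((fun j => fun c => G j c) '' {j : Fin n | j ∈ S})
    have hmap : W.map π = ⊤ := by
      rw [eq_top_iff, ← htop, Submodule.span_le]
      rintro _ ⟨j, rfl⟩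
      exact Submodule.mem_map_of_mem (Submodule.subset_span ⟨j, hbS (hBb j.2), rfl⟩)
    have hcomap := Submodule.comap_map_eq_self (hker.trans (hEle S hS.ge))
    rw [hmap, Submodule.comap_top] at hcomap
    exact hcomap.le
  refine ⟨hfull, fun S hS => ?_⟩
  obtain ⟨T, hST, -, hT⟩ := Finset.exists_subsuperset_card_eq (Finset.subset_univ S)
    (show S.card ≤ x + y by omega) (by simpa using hn)
  have hTli : LinearIndepOn F (fun j => fun c => G j c) {j : Fin n | j ∈ T} := hfull T hT
  exact hproj S hS.le (hTli.mono hST)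
end

section
/- Let q be a prime power and n, r, t integers with 1 ≤ t < r ≤ n. Let G = (G′, G″) ∈ F_q^{n×(r−t)} × F_q^{n×t}, viewed as a single matrix G ∈ F_q^{n×r}. If every r rows of G are linearly independent (i.e., the column space of G is an (n,r)-MDS code) and every t rows of G″ are linearly independent (i.e., the column space of G″ is an (n,t)-MDS code), then the pair (G, id_{[n]}), with parameters (x, y, z) = (r−t, t, n), is an (r,t,n)-MMSP. -/
/-!
STATEMENT 1: If every `r` rows of `G` are linearly independent (`(n,r)`-MDS) and every `t`
rows of the last-`t`-columns submatrix `G″` are linearly independent (`(n,t)`-MDS), then the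
pair `(G, id)` with parameters `(x, y, z) = (r−t, t, n)` is an `(r,t,n)`-MMSP.
Here we parametrize `x := r − t ≥ 1`, `y := t ≥ 1`, so `r = x + y`.
-/

/-- A family of rows that is independent on a set of size the dimension spans everything. -/
theorem span_image_eq_top_of_card_eq {F ι κ : Type*} [Field F] [Fintype κ] (v : ι → κ → F)
    (S : Finset ι) (hS : S.card = Fintype.card κ)
    (h : LinearIndependent F (fun i : {a // a ∈ S} => v i.1)) :
    Submodule.span F (v '' {j | j ∈ S}) = ⊤ := by
  have := h.span_eq_top_of_card_eq_finrank' (by simp [hS])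
  rwa [Set.image_eq_range]

/-- If the images under `f` of the vectors indexed by `S` are independent, then the span of these
vectors meets the kernel of `f` trivially. -/
theorem disjoint_ker_span_image {F V W ι : Type*} [Field F] [AddCommGroup V] [Module F V]
    [AddCommGroup W] [Module F W] (f : V →ₗ[F] W) (v : ι → V) (S : Finset ι)
    (h : LinearIndependent F (fun i : {a // a ∈ S} => f (v i.1))) :
    Disjoint (LinearMap.ker f) (Submodule.span F (v '' {j | j ∈ S})) := by
  rw [Set.image_eq_range]
  exact (Submodule.range_ker_disjoint (f := f) (v := fun i : {a // a ∈ S} => v i.1) h).symm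

theorem spir_mds_implies_mmsp
    (F : Type*) [Field F] [Fintype F]
    (n x y : ℕ) (hx : 1 ≤ x) (hy : 1 ≤ y) (hn : x + y ≤ n)
    (G : Matrix (Fin n) (Fin (x + y)) F)
    -- every `r = x + y` rows of `G` are linearly independent:
    (hG : ∀ S : Finset (Fin n), S.card = x + y →
      LinearIndependent F (fun i : {a // a ∈ S} => fun c : Fin (x + y) => G i.1 c))
    -- every `t = y` rows of `G″` are linearly independent:
    (hG'' : ∀ S : Finset (Fin n), S.card = y →
      LinearIndependent F (fun i : {a // a ∈ S} => fun c : Fin y => G i.1 (Fin.natAdd x c))) :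
    -- the MMSP `(G, id)` accepts `𝔄 = {A ⊆ [n] : |A| ≥ r}` (with `r = x + y`):
    (∀ A : Finset (Fin n), x + y ≤ A.card → ∀ i : Fin x,
      (Pi.single (Fin.castAdd y i) 1 : Fin (x + y) → F) ∈
        Submodule.span F ((fun j => fun c => G j c) '' {j : Fin n | j ∈ A}))
    ∧
    -- the MMSP `(G, id)` rejects `𝔅 = {B ⊆ [n] : |B| ≤ t}` (with `t = y`):
    (∀ B : Finset (Fin n), B.card ≤ y →
      Submodule.span F
          (Set.range fun i : Fin x =>
            (Pi.single (Fin.castAdd y i) 1 : Fin (x + y) → F))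
        ⊓ Submodule.span F ((fun j => fun c => G j c) '' {j : Fin n | j ∈ B}) = ⊥) := by
  refine ⟨fun A hA i => ?_, fun B hB => ?_⟩
  · obtain ⟨S, hSA, hS⟩ := Finset.exists_subset_card_eq hA
    have htop := span_image_eq_top_of_card_eq (fun j c => G j c) S (by simpa using hS) (hG S hS)
    exact Submodule.span_mono (Set.image_mono fun j hj => hSA hj) (htop ▸ Submodule.mem_top)
  · obtain ⟨S, hBS, hS⟩ := Finset.exists_superset_card_eq hB
      (by simpa using (Nat.le_add_left y x).trans hn)
    have hdisj := disjoint_ker_span_image (LinearMap.funLeft F F (Fin.natAdd x))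
      (fun j c => G j c) S (hG'' S hS)
    refine disjoint_iff.mp (hdisj.mono ?_ (Submodule.span_mono (Set.image_mono fun j hj => hBS hj)))
    rw [Submodule.span_le]
    rintro _ ⟨i, rfl⟩
    ext k
    have hne : Fin.natAdd x k ≠ Fin.castAdd y i := by
      simp only [ne_eq, Fin.ext_iff, Fin.val_natAdd, Fin.val_castAdd]
      omega
    simp [LinearMap.funLeft_apply, hne]
end

section
/- Let q be a prime power and t < r ≤ n positive integers. Let G = (G′, G″) ∈ F_q^{n×(r−t)} × F_q^{n×t}, viewed as G ∈ F_q^{n×r}, and let e_1,…,e_{r−t} be the first r−t standard basis row vectors of F_q^r. Suppose: (i) each of e_1,…,e_{r−t} lies in the row space of G_{[r]} (the submatrix of the first r rows of G); (ii) span{e_1,…,e_{r−t}} ∩ rowspan(G_{[t]}) = {0} (where G_{[t]} is the submatrix of the first t rows); and (iii) the t×t matrix G″_{[t]} formed by the first t rows of G″ has rank t. Then the r×r matrix G_{[r]} is invertible. -/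
/-!
STATEMENT 3: With `t < r ≤ n` (parametrized as `t = y ≥ 1`, `r = x + y`, `x ≥ 1`),
if (i) each of `e_1,…,e_{r−t}` lies in the row space of the first `r` rows of `G`,
(ii) `span{e_1,…,e_{r−t}} ∩ rowspan(G_{[t]}) = {0}`, and
(iii) the `t×t` matrix formed by the first `t` rows of `G″` has rank `t`,
then the `r×r` matrix `G_{[r]}` formed by the first `r` rows of `G` is invertible.
-/

/-- A subspace of `F^(x+y)` which contains the first `x` standard basis vectors and projects onto
the last `y` coordinates is everything. -/
theorem Submodule.eq_top_of_single_castAdd_mem {F : Type*} [Field F] {x y : ℕ}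
    {W : Submodule F (Fin (x + y) → F)}
    (hsingle : ∀ i : Fin x, Pi.single (Fin.castAdd y i) 1 ∈ W)
    (hmap : W.map (LinearMap.funLeft F F (Fin.natAdd x)) = ⊤) : W = ⊤ := by
  refine eq_top_iff.2 fun v _ => ?_
  obtain ⟨w, hw, hwv⟩ : LinearMap.funLeft F F (Fin.natAdd x) v ∈
      W.map (LinearMap.funLeft F F (Fin.natAdd x)) := hmap ▸ Submodule.mem_top
  have hlast (j : Fin y) : w (Fin.natAdd x j) = v (Fin.natAdd x j) := congrFun hwv j
  have hdiff : v - w ∈ W := by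
    rw [pi_eq_sum_univ' (v - w), Fin.sum_univ_add]
    refine W.add_mem (W.sum_mem fun i _ => W.smul_mem _ ?_) (W.sum_mem fun j _ => ?_)
    · simpa [Pi.single_apply, funext_iff, Pi.single, Function.update_apply, eq_comm] using hsingle i
    · simp [hlast]
  simpa using W.add_mem hdiff hw

/-- A square matrix over a field whose rows span is invertible. -/
theorem Matrix.isUnit_of_span_row_eq_top {F m : Type*} [Field F] [Fintype m] [DecidableEq m]
    {A : Matrix m m F} (h : Submodule.span F (Set.range A.row) = ⊤) : IsUnit A :=
  Matrix.linearIndependent_rows_iff_isUnit.1 <|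
    linearIndependent_of_top_le_span_of_card_eq_finrank h.ge (by simp)

theorem spir_first_r_rows_invertible
    (F : Type*) [Field F] [Fintype F]
    (n x y : ℕ) (hx : 1 ≤ x) (hy : 1 ≤ y) (hr : x + y ≤ n)
    (G : Matrix (Fin n) (Fin (x + y)) F)
    -- (i) each standard basis vector `e_i` (`i ≤ x = r − t`) lies in the row space of the
    -- first `r = x + y` rows of `G`:
    (h1 : ∀ i : Fin x,
      (Pi.single (Fin.castAdd y i) 1 : Fin (x + y) → F) ∈
        Submodule.span F ((fun j => fun c => G j c) '' {j : Fin n | (j : ℕ) < x + y}))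
    -- (ii) `span{e_1,…,e_x} ∩ rowspan(G_{[t]}) = {0}` (first `t = y` rows):
    (h2 : Submodule.span F
          (Set.range fun i : Fin x =>
            (Pi.single (Fin.castAdd y i) 1 : Fin (x + y) → F))
        ⊓ Submodule.span F ((fun j => fun c => G j c) '' {j : Fin n | (j : ℕ) < y}) = ⊥)
    -- (iii) the `t×t` matrix `G″_{[t]}` has rank `t = y`:
    (h3 : Module.finrank F
        ↥(Submodule.span F
          ((fun j => fun c : Fin y => G j (Fin.natAdd x c)) '' {j : Fin n | (j : ℕ) < y}))
      = y) :
    -- the `r×r` matrix of the first `r = x + y` rows of `G` is invertible: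
    IsUnit (Matrix.of fun (i j : Fin (x + y)) => G (Fin.castLE hr i) j) := by
  have hrows : Set.range
      (Matrix.row (Matrix.of fun (i j : Fin (x + y)) => G (Fin.castLE hr i) j)) =
      (fun j => fun c => G j c) '' {j : Fin n | (j : ℕ) < x + y} := by
    ext v
    constructor
    · rintro ⟨i, rfl⟩
      exact ⟨Fin.castLE hr i, i.isLt, rfl⟩
    · rintro ⟨j, hj, rfl⟩
      exact ⟨⟨j, hj⟩, rfl⟩
  refine Matrix.isUnit_of_span_row_eq_top (hrows ▸ ?_)
  refine Submodule.eq_top_of_single_castAdd_mem h1 (eq_top_iff.2 ?_)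
  rw [← Submodule.eq_top_of_finrank_eq (h3.trans (Module.finrank_fin_fun F).symm),
    Submodule.map_span, Set.image_image]
  exact Submodule.span_mono (Set.image_mono fun j (hj : (j : ℕ) < y) => hj.trans_le (by omega))
end

section
/- Let q be a prime power, G=(G′,G″)∈F_q^{z×x}×F_q^{z×y}, and S⊆[z] a set of row indices such that span{e_1,…,e_x} ∩ rowspan((G′,G″)_S) = {0}, where e_1,…,e_x are the first x standard basis row vectors of F_q^{x+y}. Let Y be a uniformly distributed random vector in F_q^y. Then for every v∈F_q^x the probability distribution of G′_S v + G″_S Y equals the distribution of G″_S Y; equivalently, if X is any random variable in F_q^x independent of Y, then the random vector Z_S = G′_S X + G″_S Y is independent of X. -/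
/-!
STATEMENT 4: If `span{e_1,…,e_x} ∩ rowspan((G′,G″)_S) = {0}`, then for a uniform
`Y ∈ F_q^y` and every `v ∈ F_q^x` the distribution of `G′_S v + G″_S Y` equals the
distribution of `G″_S Y`.  Since `Y` is uniform on a finite set, equality of the two
distributions is expressed by equality of the number of `Y`'s realizing each outcome.
-/

/-- If every combination of rows that kills `B` also kills `A`, then
every `A v` lies in the column space of `B`. -/
theorem exists_mulVec_eq_of_vecMul_eq_zero {F ι m n : Type*} [Field F] [Fintype ι]
    [Fintype m] [Fintype n] (A : Matrix ι m F) (B : Matrix ι n F)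
    (h : ∀ c : ι → F, Matrix.vecMul c B = 0 → Matrix.vecMul c A = 0) (v : m → F) :
    ∃ u, B.mulVec u = A.mulVec v := by
  classical
  by_contra hv
  have hmem : A.mulVec v ∉ LinearMap.range B.mulVecLin := by
    rintro ⟨u, hu⟩
    exact hv ⟨u, hu⟩
  obtain ⟨f, hfv, hf⟩ := Submodule.exists_le_ker_of_notMem hmem
  have hfc (b : ι → F) : f b = (fun j => f (Pi.single j 1)) ⬝ᵥ b := by
    rw [LinearMap.pi_apply_eq_sum_univ f b]
    simp only [dotProduct, smul_eq_mul, mul_comm]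
    refine Finset.sum_congr rfl fun j _ => ?_
    congr 2
    ext k
    simp [Pi.single_apply, eq_comm]
  apply hfv
  rw [hfc, Matrix.dotProduct_mulVec, h, zero_dotProduct]
  refine dotProduct_eq_zero _ fun u => ?_
  rw [← Matrix.dotProduct_mulVec, ← hfc]
  exact hf ⟨u, rfl⟩

/-- A vector whose last `y` coordinates vanish lies in the span of the first `x` standard basis
vectors. -/
theorem append_zero_mem_span_single {F : Type*} [Field F] {x y : ℕ} (a : Fin x → F) :
    (Fin.append a 0 : Fin (x + y) → F) ∈ Submodule.span F
      (Set.range fun i : Fin x => (Pi.single (Fin.castAdd y i) 1 : Fin (x + y) → F)) := by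
  have ha : (Fin.append a 0 : Fin (x + y) → F) =
      ∑ i, a i • (Pi.single (Fin.castAdd y i) 1 : Fin (x + y) → F) := by
    ext k
    refine Fin.addCases (fun k => ?_) (fun k => ?_) k
    · simp [Finset.sum_apply, Pi.single_apply]
    · simp only [Fin.append_right, Pi.zero_apply, Finset.sum_apply, Pi.smul_apply, smul_eq_mul]
      refine (Finset.sum_eq_zero fun i _ => ?_).symm
      rw [Pi.single_eq_of_ne, mul_zero]
      simp [Fin.ext_iff]
      omega
  rw [ha]
  exact Submodule.sum_mem _ fun i _ => Submodule.smul_mem _ _ (Submodule.subset_span ⟨i, rfl⟩)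

theorem spir_shifted_distribution_eq
    (F : Type*) [Field F] [Fintype F]
    (x y z : ℕ)
    (G' : Matrix (Fin z) (Fin x) F) (G'' : Matrix (Fin z) (Fin y) F)
    (S : Finset (Fin z))
    -- `span{e_1,…,e_x} ∩ rowspan((G′,G″)_S) = {0}`:
    (hrej : Submodule.span F
          (Set.range fun i : Fin x =>
            (Pi.single (Fin.castAdd y i) 1 : Fin (x + y) → F))
        ⊓ Submodule.span F
          ((fun j => Fin.append (fun c => G' j c) (fun c => G'' j c)) '' (S : Set (Fin z)))
      = ⊥) :
    -- for every `v`, the distribution of `G′_S v + G″_S Y` (uniform `Y`) equals that of `G″_S Y`: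
    ∀ (v : Fin x → F) (w : Fin z → F),
      Nat.card {u : Fin y → F // ∀ j ∈ S, G'.mulVec v j + G''.mulVec u j = w j}
        = Nat.card {u : Fin y → F // ∀ j ∈ S, G''.mulVec u j = w j} := by
  intro v w
  obtain ⟨u₀, hu₀⟩ := exists_mulVec_eq_of_vecMul_eq_zero
    (fun (j : S) c => G' j c) (fun (j : S) c => G'' j c) (fun c hc => by
      have hrow : (Fin.append (Matrix.vecMul c fun (j : S) k => G' j k) 0 : Fin (x + y) → F) =
          ∑ j : S, c j • (Fin.append (fun k => G' j k) (fun k => G'' j k) : Fin (x + y) → F) := by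
        rw [← hc]
        ext k
        refine Fin.addCases (fun k => ?_) (fun k => ?_) k <;>
          simp [Matrix.vecMul, dotProduct, Finset.sum_apply]
      have hmem : (Fin.append (Matrix.vecMul c fun (j : S) k => G' j k) 0 : Fin (x + y) → F) ∈
          (⊥ : Submodule F (Fin (x + y) → F)) := by
        rw [← hrej]
        refine ⟨append_zero_mem_span_single _, ?_⟩
        rw [hrow]
        exact Submodule.sum_mem _ fun j _ =>
          Submodule.smul_mem _ _ (Submodule.subset_span ⟨j, j.2, rfl⟩)
      ext k
      simpa using congrFun ((Submodule.mem_bot F).1 hmem) (Fin.castAdd y k)) v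
  refine Nat.card_congr ((Equiv.addRight u₀).subtypeEquiv fun u => ?_)
  refine forall₂_congr fun j hj => ?_
  have hj₀ : G''.mulVec u₀ j = G'.mulVec v j := congrFun hu₀ ⟨j, hj⟩
  rw [Equiv.coe_addRight, Matrix.mulVec_add, Pi.add_apply, hj₀, add_comm]
end

section
/- Let q be a prime power, G ∈ F_q^{z×(x+y)}, and S ⊆ [z] a set of row indices. Suppose there exists a function h : F_q^{|S|} → F_q^x such that h(G_S · (l;w)) = l for every l ∈ F_q^x and w ∈ F_q^y, where (l;w) denotes the concatenated column vector. Then each of the standard basis row vectors e_1,…,e_x of F_q^{x+y} lies in the row space of G_S; consequently there exists a matrix K ∈ F_q^{x×|S|} with K·G_S = (I_x | 0_{x×y}), where I_x is the x×x identity matrix and 0_{x×y} the x×y zero matrix. -/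
/-!
STATEMENT 6: If there is a function `h` with `h(G_S·(l;w)) = l` for all `l ∈ F_q^x`,
`w ∈ F_q^y`, then each standard basis row vector `e_1,…,e_x` of `F_q^{x+y}` lies in the row
space of `G_S`; consequently there is a matrix `K` with `K·G_S = (I_x | 0_{x×y})`.
-/

theorem spir_recovery_implies_span
    (F : Type*) [Field F] [Fintype F]
    (x y z : ℕ)
    (G : Matrix (Fin z) (Fin (x + y)) F)
    (S : Finset (Fin z))
    -- there is `h : F^{|S|} → F^x` with `h (G_S (l;w)) = l` for all `l, w`:
    (hrec : ∃ h : ({j // j ∈ S} → F) → (Fin x → F),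
      ∀ (l : Fin x → F) (w : Fin y → F),
        h (fun j => G.mulVec (Fin.append l w) j.1) = l) :
    -- each `e_i` lies in the row space of `G_S`:
    (∀ i : Fin x,
      (Pi.single (Fin.castAdd y i) 1 : Fin (x + y) → F) ∈
        Submodule.span F ((fun j => fun c => G j c) '' (S : Set (Fin z))))
    ∧
    -- there is `K` with `K · G_S = (I_x | 0_{x×y})`:
    (∃ K : Matrix (Fin x) {j // j ∈ S} F,
      ∀ (i : Fin x) (c : Fin (x + y)),
        (∑ j : {j // j ∈ S}, K i j * G j.1 c)
          = if c = Fin.castAdd y i then 1 else 0) := by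
  obtain ⟨h, hh⟩ := hrec
  have append_castAdd_natAdd (v : Fin (x + y) → F) :
      Fin.append (fun i => v (Fin.castAdd y i)) (fun i => v (Fin.natAdd x i)) = v :=
    Fin.append_castAdd_natAdd
  have ker_le (v : Fin (x + y) → F) (hv : ∀ j : {j // j ∈ S}, G.mulVec v j.1 = 0)
      (i : Fin x) : v (Fin.castAdd y i) = 0 := by
    have h_v := hh (fun i => v (Fin.castAdd y i)) (fun i => v (Fin.natAdd x i))
    have h_zero := hh (fun i => (0 : Fin (x + y) → F) (Fin.castAdd y i))
      (fun i => (0 : Fin (x + y) → F) (Fin.natAdd x i))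
    rw [append_castAdd_natAdd] at h_v h_zero
    simp only [hv] at h_v
    simp only [Matrix.mulVec_zero, Pi.zero_apply] at h_zero
    exact congrFun (h_v.symm.trans h_zero) i
  have exists_coeff (i : Fin x) : ∃ k : {j // j ∈ S} → F, ∀ c : Fin (x + y),
      ∑ j, k j * G j.1 c = if c = Fin.castAdd y i then 1 else 0 := by
    have hmem := mem_span_of_iInf_ker_le_ker
      (L := fun j : {j // j ∈ S} => (LinearMap.proj j.1).comp G.mulVecLin)
      (K := (LinearMap.proj (Fin.castAdd y i) : (Fin (x + y) → F) →ₗ[F] F)) (by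
        intro v hv
        simp only [Submodule.mem_iInf, LinearMap.mem_ker] at hv ⊢
        exact ker_le v hv i)
    obtain ⟨k, hk⟩ := (Submodule.mem_span_range_iff_exists_fun F).1 hmem
    refine ⟨k, fun c => ?_⟩
    have hc := LinearMap.congr_fun hk (Pi.single c 1)
    simpa [Pi.single_apply, eq_comm] using hc
  choose K hK using exists_coeff
  refine ⟨fun i => ?_, K, hK⟩
  have hsum : (Pi.single (Fin.castAdd y i) 1 : Fin (x + y) → F) =
      ∑ j : {j // j ∈ S}, K i j • fun c => G j.1 c := by
    ext c
    simp only [Finset.sum_apply, Pi.smul_apply, smul_eq_mul, hK, Pi.single_apply]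
  rw [hsum]
  exact Submodule.sum_mem _ fun j _ =>
    Submodule.smul_mem _ _ (Submodule.subset_span ⟨j.1, j.2, rfl⟩)
end

section
/- Let q be a prime power, G=(G′,G″)∈F_q^{z×x}×F_q^{z×y}, and S⊆[z] a set of row indices. Let L be uniformly distributed on F_q^x and W uniformly distributed on F_q^y, independent of each other. If the random vector S_B := G′_S L + G″_S W is independent of L, then rank(G″_S) = rank((G′,G″)_S); equivalently, span{e_1,…,e_x} ∩ rowspan((G′,G″)_S) = {0}, where e_1,…,e_x are the first x standard basis row vectors of F_q^{x+y}. -/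
open scoped Classical BigOperators

/-- A probability mass function on a finite sample space. -/
def IsPMF {Ω : Type*} [Fintype Ω] (p : Ω → ℝ) : Prop :=
  (∀ ω, 0 ≤ p ω) ∧ ∑ ω, p ω = 1

/-- The uniform probability mass function. -/
noncomputable def uniformPMF (Ω : Type*) [Fintype Ω] : Ω → ℝ :=
  fun _ => (Fintype.card Ω : ℝ)⁻¹

/-- Distribution of the random variable `X` under the mass function `p`. -/
noncomputable def distOf {Ω α : Type*} [Fintype Ω] (p : Ω → ℝ) (X : Ω → α) (a : α) : ℝ :=
  ∑ ω, if X ω = a then p ω else 0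

/-- Probability of the event `E` under the mass function `p`. -/
noncomputable def prEvent {Ω : Type*} [Fintype Ω] (p : Ω → ℝ) (E : Ω → Prop) : ℝ :=
  ∑ ω, if E ω then p ω else 0

/-- Conditional probability mass function given the event `E`. -/
noncomputable def condPMF {Ω : Type*} [Fintype Ω] (p : Ω → ℝ) (E : Ω → Prop) : Ω → ℝ :=
  fun ω => if E ω then p ω / prEvent p E else 0

/-- Conditional probability of `A` given the event `E`. -/
noncomputable def condProb {Ω : Type*} [Fintype Ω] (p : Ω → ℝ) (A E : Ω → Prop) : ℝ :=
  prEvent p (fun ω => A ω ∧ E ω) / prEvent p E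

/-- Shannon entropy (natural logarithm) of the random variable `X` under `p`. -/
noncomputable def entropy {Ω α : Type*} [Fintype Ω] [Fintype α]
    (p : Ω → ℝ) (X : Ω → α) : ℝ :=
  -∑ a, distOf p X a * Real.log (distOf p X a)

/-- Shannon mutual information `I(X;Y)` (natural logarithm) under `p`. -/
noncomputable def mutualInfo {Ω α β : Type*} [Fintype Ω] [Fintype α] [Fintype β]
    (p : Ω → ℝ) (X : Ω → α) (Y : Ω → β) : ℝ :=
  entropy p X + entropy p Y - entropy p (fun ω => (X ω, Y ω))

/-- Conditional mutual information `I(X;Y∣Z)` (natural logarithm) under `p`. -/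
noncomputable def condMutualInfo {Ω α β γ : Type*} [Fintype Ω] [Fintype α] [Fintype β]
    [Fintype γ] (p : Ω → ℝ) (X : Ω → α) (Y : Ω → β) (Z : Ω → γ) : ℝ :=
  entropy p (fun ω => (X ω, Z ω)) + entropy p (fun ω => (Y ω, Z ω))
    - entropy p (fun ω => (X ω, Y ω, Z ω)) - entropy p Z

/-- Independence of the random variables `X` and `Y` under `p`. -/
def IndepRV {Ω α β : Type*} [Fintype Ω] (p : Ω → ℝ) (X : Ω → α) (Y : Ω → β) : Prop :=
  ∀ a b, distOf p (fun ω => (X ω, Y ω)) (a, b) = distOf p X a * distOf p Y b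

/-- The binary entropy function `h₂(p) = −p log p − (1−p) log(1−p)`. -/
noncomputable def binEnt (t : ℝ) : ℝ :=
  -t * Real.log t - (1 - t) * Real.log (1 - t)

/-- Under a strictly positive mass function, every attained value has positive probability. -/
lemma distOf_self_pos {Ω α : Type*} [Fintype Ω] {p : Ω → ℝ} (hp : ∀ ω, 0 < p ω) (X : Ω → α)
    (ω₀ : Ω) : 0 < distOf p X (X ω₀) := by
  refine Finset.sum_pos' (fun ω _ => ?_) ⟨ω₀, Finset.mem_univ _, ?_⟩
  · split_ifs
    exacts [(hp ω).le, le_rfl]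
  · simpa using hp ω₀

/-- If `X` and `Y` are independent under a strictly positive mass function, then any value of `X`
and any value of `Y` that are attained separately are attained jointly. -/
lemma IndepRV.exists_eq_and_eq {Ω α β : Type*} [Fintype Ω] {p : Ω → ℝ} {X : Ω → α} {Y : Ω → β}
    (h : IndepRV p X Y) (hp : ∀ ω, 0 < p ω) (ω₁ ω₂ : Ω) :
    ∃ ω, X ω = X ω₁ ∧ Y ω = Y ω₂ := by
  by_contra! hne
  have hzero : distOf p (fun ω => (X ω, Y ω)) (X ω₁, Y ω₂) = 0 :=
    Finset.sum_eq_zero fun ω _ => if_neg fun he =>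
      hne ω (congrArg Prod.fst he) (congrArg Prod.snd he)
  have hprod : 0 < distOf p X (X ω₁) * distOf p Y (Y ω₂) :=
    mul_pos (distOf_self_pos hp X ω₁) (distOf_self_pos hp Y ω₂)
  rw [← h, hzero] at hprod
  exact hprod.false

lemma uniformPMF_pos {Ω : Type*} [Fintype Ω] (ω : Ω) : 0 < uniformPMF Ω ω :=
  inv_pos.2 (Nat.cast_pos.2 (Fintype.card_pos_iff.2 ⟨ω⟩))

/-- If `G' L + G'' W`, restricted to the rows in `S`, is independent of `L`, then every linear
relation among the rows of `G''` indexed by `S` also holds among those of `G'`. -/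
lemma sum_smul_row_eq_zero_of_indepRV {F m n r : Type*} [Field F] [Fintype F] [Fintype m]
    [Fintype n] [DecidableEq m] [DecidableEq n] {G' : Matrix r m F} {G'' : Matrix r n F}
    {S : Finset r}
    (hindep : IndepRV (uniformPMF ((m → F) × (n → F)))
      (fun ω => fun j : {j // j ∈ S} => G'.mulVec ω.1 j.1 + G''.mulVec ω.2 j.1) Prod.fst)
    {c : r → F} (hc : ∑ j ∈ S, c j • G'' j = 0) : ∑ j ∈ S, c j • G' j = 0 := by
  refine dotProduct_eq_zero _ fun l => ?_
  obtain ⟨⟨l', w⟩, hS, hl⟩ := hindep.exists_eq_and_eq uniformPMF_pos (0, 0) (l, 0)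
  obtain rfl : l' = l := hl
  have hrow : ∀ j ∈ S, G' j ⬝ᵥ l' + G'' j ⬝ᵥ w = 0 := fun j hj => by
    simpa [Matrix.mulVec] using congrFun hS ⟨j, hj⟩
  calc (∑ j ∈ S, c j • G' j) ⬝ᵥ l'
      = (∑ j ∈ S, c j • G' j) ⬝ᵥ l' + (∑ j ∈ S, c j • G'' j) ⬝ᵥ w := by simp [hc]
    _ = ∑ j ∈ S, c j * (G' j ⬝ᵥ l' + G'' j ⬝ᵥ w) := by
        simp only [sum_dotProduct, smul_dotProduct, smul_eq_mul, mul_add, Finset.sum_add_distrib]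
    _ = 0 := Finset.sum_eq_zero fun j hj => by rw [hrow j hj, mul_zero]

/-!
STATEMENT 7: If, for independent uniform `L ∈ F_q^x` and `W ∈ F_q^y`, the random vector
`S_B = G′_S L + G″_S W` is independent of `L`, then `rank(G″_S) = rank((G′,G″)_S)`;
equivalently `span{e_1,…,e_x} ∩ rowspan((G′,G″)_S) = {0}`.
-/

theorem spir_indep_implies_rank_eq
    (F : Type*) [Field F] [Fintype F]
    (x y z : ℕ)
    (G' : Matrix (Fin z) (Fin x) F) (G'' : Matrix (Fin z) (Fin y) F)
    (S : Finset (Fin z))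
    -- `S_B = G′_S L + G″_S W` is independent of `L` (uniform `(L, W)`):
    (hindep : IndepRV (uniformPMF ((Fin x → F) × (Fin y → F)))
      (fun ω => fun j : {j // j ∈ S} => G'.mulVec ω.1 j.1 + G''.mulVec ω.2 j.1)
      Prod.fst) :
    -- `rank(G″_S) = rank((G′,G″)_S)`:
    (Module.finrank F
        ↥(Submodule.span F ((fun j => fun c => G'' j c) '' (S : Set (Fin z))))
      = Module.finrank F
        ↥(Submodule.span F
          ((fun j => Fin.append (fun c => G' j c) (fun c => G'' j c)) '' (S : Set (Fin z)))))
    ∧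
    -- equivalently, `span{e_1,…,e_x} ∩ rowspan((G′,G″)_S) = {0}`:
    (Submodule.span F
        (Set.range fun i : Fin x =>
          (Pi.single (Fin.castAdd y i) 1 : Fin (x + y) → F))
      ⊓ Submodule.span F
        ((fun j => Fin.append (fun c => G' j c) (fun c => G'' j c)) '' (S : Set (Fin z)))
      = ⊥) := by
  set R := Submodule.span F
    ((fun j => Fin.append (fun c => G' j c) (fun c => G'' j c)) '' (S : Set (Fin z))) with hR
  let P : (Fin (x + y) → F) →ₗ[F] (Fin y → F) := LinearMap.funLeft F F (Fin.natAdd x)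
  have hker : ∀ v ∈ R, P v = 0 → v = 0 := by
    intro v hv hPv
    obtain ⟨c, rfl⟩ := (Submodule.mem_span_image_finset_iff_exists_fun' F).1 hv
    have hc'' : (∑ j ∈ S, c j • G'' j : Fin y → F) = 0 := by
      rw [← hPv]
      ext k
      simp [P, LinearMap.funLeft_apply, Finset.sum_apply]
    have hc' : (∑ j ∈ S, c j • G' j : Fin x → F) = 0 :=
      sum_smul_row_eq_zero_of_indepRV hindep hc''
    ext k
    refine Fin.addCases (fun i => ?_) (fun i => ?_) k
    · simpa [Finset.sum_apply] using congrFun hc' i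
    · simpa [Finset.sum_apply] using congrFun hc'' i
  constructor
  · have hmap : Submodule.span F ((fun j => fun c => G'' j c) '' (S : Set (Fin z))) = R.map P := by
      rw [hR, Submodule.map_span, Set.image_image]
      congr 2
      ext j k
      simp [P, LinearMap.funLeft_apply]
    have hinj : Function.Injective (P.domRestrict R) :=
      (injective_iff_map_eq_zero _).2 fun v hv => Subtype.ext (hker v v.2 hv)
    rw [hmap, ← LinearMap.range_domRestrict]
    exact LinearMap.finrank_range_of_inj hinj
  · refine (Submodule.eq_bot_iff _).2 fun v hv => hker v hv.2 ?_
    have hle : Submodule.span F (Set.range fun i : Fin x =>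
        (Pi.single (Fin.castAdd y i) 1 : Fin (x + y) → F)) ≤ LinearMap.ker P := by
      rw [Submodule.span_le]
      rintro _ ⟨i, rfl⟩
      ext k
      have hne : Fin.natAdd x k ≠ Fin.castAdd y i := by
        simp only [ne_eq, Fin.ext_iff, Fin.val_natAdd, Fin.val_castAdd]
        omega
      simp [P, LinearMap.funLeft_apply, hne]
    exact hle hv.1
end

section
/- Let f ≥ 2 be an integer, K a random variable uniformly distributed on [f], Q a random variable on a finite set, and X a random variable on a finite set such that X is conditionally independent of K given Q (Markov chain K → Q → X). If the Shannon mutual information (natural logarithm) satisfies I(K;Q) ≤ γ, then for all k, k′ ∈ [f], the total variation distance between the conditional joint distribution of (X,Q) given K=k and that given K=k′ is at most √(2γf), where the total variation distance between distributions p and q on a finite set is d(p,q) = (1/2)·Σ_u |p(u)−q(u)|. -/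
open scoped Classical BigOperators

theorem distOf_nonneg {Ω α : Type*} [Fintype Ω] {p : Ω → ℝ} (hp : ∀ ω, 0 ≤ p ω)
    (X : Ω → α) (a : α) : 0 ≤ distOf p X a :=
  Finset.sum_nonneg fun ω _ => by split_ifs <;> simp [hp ω]

theorem sum_distOf {Ω α : Type*} [Fintype Ω] [Fintype α] (p : Ω → ℝ) (X : Ω → α) :
    ∑ a, distOf p X a = ∑ ω, p ω := by
  unfold distOf
  rw [Finset.sum_comm]
  simp

theorem sum_distOf_prod_right {Ω α β : Type*} [Fintype Ω] [Fintype β] (p : Ω → ℝ)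
    (X : Ω → α) (Y : Ω → β) (a : α) :
    ∑ b, distOf p (fun ω => (X ω, Y ω)) (a, b) = distOf p X a := by
  unfold distOf
  rw [Finset.sum_comm]
  refine Finset.sum_congr rfl fun ω _ => ?_
  by_cases h : X ω = a <;> simp [Prod.ext_iff, h]

theorem sum_distOf_prod_left {Ω α β : Type*} [Fintype Ω] [Fintype α] (p : Ω → ℝ)
    (X : Ω → α) (Y : Ω → β) (b : β) :
    ∑ a, distOf p (fun ω => (X ω, Y ω)) (a, b) = distOf p Y b := by
  unfold distOf
  rw [Finset.sum_comm]
  refine Finset.sum_congr rfl fun ω _ => ?_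
  by_cases h : Y ω = b <;> simp [Prod.ext_iff, h]

theorem condProb_eq_distOf_div {Ω α κ : Type*} [Fintype Ω] (p : Ω → ℝ)
    (Y : Ω → α) (K : Ω → κ) (y : α) (k : κ) :
    condProb p (fun ω => Y ω = y) (fun ω => K ω = k)
      = distOf p (fun ω => (K ω, Y ω)) (k, y) / distOf p K k := by
  unfold condProb prEvent distOf
  simp only [Prod.mk.injEq, and_comm]
  congr!

/-- The mutual information as a sum over the joint distribution. -/
theorem mutualInfo_eq_sum {Ω α β : Type*} [Fintype Ω] [Fintype α] [Fintype β]
    (p : Ω → ℝ) (X : Ω → α) (Y : Ω → β) :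
    mutualInfo p X Y = ∑ a, ∑ b, distOf p (fun ω => (X ω, Y ω)) (a, b)
      * (Real.log (distOf p (fun ω => (X ω, Y ω)) (a, b))
        - Real.log (distOf p X a) - Real.log (distOf p Y b)) := by
  have hX : ∑ a, distOf p X a * Real.log (distOf p X a)
      = ∑ a, ∑ b, distOf p (fun ω => (X ω, Y ω)) (a, b) * Real.log (distOf p X a) :=
    Finset.sum_congr rfl fun a _ => by rw [← Finset.sum_mul, sum_distOf_prod_right]
  have hY : ∑ b, distOf p Y b * Real.log (distOf p Y b)
      = ∑ a, ∑ b, distOf p (fun ω => (X ω, Y ω)) (a, b) * Real.log (distOf p Y b) := by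
    rw [Finset.sum_comm]
    exact Finset.sum_congr rfl fun b _ => by rw [← Finset.sum_mul, sum_distOf_prod_left]
  unfold mutualInfo entropy
  rw [hX, hY, Fintype.sum_prod_type]
  simp only [mul_sub, Finset.sum_sub_distrib]
  ring

theorem sub_add_sq_sqrt_sub_sqrt_le_mul_log {r a b : ℝ} (hr : 0 ≤ r) (ha : 0 ≤ a) (hb : 0 ≤ b)
    (hra : r ≤ a) (hrb : r ≤ b) :
    r - a * b + (√r - √(a * b)) ^ 2 ≤ r * (Real.log r - Real.log a - Real.log b) := by
  have key : r - a * b + (√r - √(a * b)) ^ 2 = 2 * r - 2 * (√r * √(a * b)) := by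
    linear_combination Real.sq_sqrt hr + Real.sq_sqrt (mul_nonneg ha hb)
  rw [key]
  rcases hr.eq_or_lt with rfl | hr
  · simp
  have ha : 0 < a := hr.trans_le hra
  have hb : 0 < b := hr.trans_le hrb
  have hs : 0 < √r := Real.sqrt_pos.2 hr
  have ht : 0 < √(a * b) := Real.sqrt_pos.2 (mul_pos ha hb)
  have hlog := Real.log_le_sub_one_of_pos (div_pos ht hs)
  rw [Real.log_div ht.ne' hs.ne', Real.log_sqrt (mul_pos ha hb).le, Real.log_sqrt hr.le,
    Real.log_mul ha.ne' hb.ne'] at hlog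
  have hmul := mul_le_mul_of_nonneg_left hlog (by positivity : 0 ≤ 2 * r)
  have hdiv : r * (√(a * b) / √r) = √r * √(a * b) := by
    rw [mul_div_left_comm, Real.div_sqrt, mul_comm]
  linarith

/-- The mutual information is at least the squared Hellinger distance between the joint
distribution and the product of the marginals. -/
theorem sum_sq_sqrt_sub_sqrt_le_mutualInfo {Ω α β : Type*} [Fintype Ω] [Fintype α] [Fintype β]
    {p : Ω → ℝ} (hp : IsPMF p) (X : Ω → α) (Y : Ω → β) :
    ∑ a, ∑ b, (√(distOf p (fun ω => (X ω, Y ω)) (a, b)) - √(distOf p X a * distOf p Y b)) ^ 2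
      ≤ mutualInfo p X Y := by
  rw [mutualInfo_eq_sum]
  have h0 : ∑ a, ∑ b, (distOf p (fun ω => (X ω, Y ω)) (a, b) - distOf p X a * distOf p Y b)
      = 0 := by
    simp only [Finset.sum_sub_distrib, sum_distOf_prod_right, ← Finset.mul_sum, sum_distOf,
      ← Finset.sum_mul, hp.2]
    norm_num
  rw [← zero_add (∑ a, ∑ b, _ ^ 2), ← h0, ← Finset.sum_add_distrib]
  refine Finset.sum_le_sum fun a _ => ?_
  rw [← Finset.sum_add_distrib]
  refine Finset.sum_le_sum fun b _ => ?_
  refine sub_add_sq_sqrt_sub_sqrt_le_mul_log (distOf_nonneg hp.1 _ _) (distOf_nonneg hp.1 _ _)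
    (distOf_nonneg hp.1 _ _) ?_ ?_
  · rw [← sum_distOf_prod_right p X Y a]
    exact Finset.single_le_sum (f := fun b => distOf p (fun ω => (X ω, Y ω)) (a, b))
      (fun _ _ => distOf_nonneg hp.1 _ _) (Finset.mem_univ b)
  · rw [← sum_distOf_prod_left p X Y b]
    exact Finset.single_le_sum (f := fun a => distOf p (fun ω => (X ω, Y ω)) (a, b))
      (fun _ _ => distOf_nonneg hp.1 _ _) (Finset.mem_univ a)

theorem sq_sum_abs_sub_le_hellinger {ι : Type*} [Fintype ι] {u v : ι → ℝ} (hu : ∀ i, 0 ≤ u i)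
    (hv : ∀ i, 0 ≤ v i) :
    (∑ i, |u i - v i|) ^ 2
      ≤ 2 * (∑ i, u i + ∑ i, v i) * ∑ i, (√(u i) - √(v i)) ^ 2 := by
  have hfac : ∀ i, |u i - v i| = |√(u i) - √(v i)| * (√(u i) + √(v i)) := fun i => by
    rw [← abs_of_nonneg (add_nonneg (Real.sqrt_nonneg (u i)) (Real.sqrt_nonneg (v i))),
      ← abs_mul]
    congr 1
    linear_combination Real.sq_sqrt (hv i) - Real.sq_sqrt (hu i)
  have hadd : ∑ i, (√(u i) + √(v i)) ^ 2 ≤ 2 * (∑ i, u i + ∑ i, v i) := by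
    rw [← Finset.sum_add_distrib, Finset.mul_sum]
    refine Finset.sum_le_sum fun i _ => ?_
    nlinarith [Real.sq_sqrt (hu i), Real.sq_sqrt (hv i), sq_nonneg (√(u i) - √(v i))]
  calc (∑ i, |u i - v i|) ^ 2
      = (∑ i, |√(u i) - √(v i)| * (√(u i) + √(v i))) ^ 2 := by simp only [hfac]
    _ ≤ (∑ i, |√(u i) - √(v i)| ^ 2) * ∑ i, (√(u i) + √(v i)) ^ 2 :=
        Finset.sum_mul_sq_le_sq_mul_sq _ _ _
    _ = (∑ i, (√(u i) + √(v i)) ^ 2) * ∑ i, (√(u i) - √(v i)) ^ 2 := by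
        simp only [sq_abs, mul_comm]
    _ ≤ _ := mul_le_mul_of_nonneg_right hadd (Finset.sum_nonneg fun _ _ => sq_nonneg _)

/-- Under the Markov condition, adjoining `X` to `Q` does not increase the `ℓ¹` distance between
the slices of the joint distribution with `K`. -/
theorem sum_abs_sub_le_of_markov {Ω κ 𝒬 𝒳 : Type*} [Fintype Ω] [Fintype 𝒬] [Fintype 𝒳]
    {p : Ω → ℝ} (hp : ∀ ω, 0 ≤ p ω) (K : Ω → κ) (Q : Ω → 𝒬) (X : Ω → 𝒳)
    (hMarkov : ∀ (k : κ) (q : 𝒬) (xv : 𝒳),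
      distOf p (fun ω => (K ω, X ω, Q ω)) (k, xv, q) * distOf p Q q
        = distOf p (fun ω => (K ω, Q ω)) (k, q)
          * distOf p (fun ω => (X ω, Q ω)) (xv, q)) (k k' : κ) :
    ∑ xq : 𝒳 × 𝒬, |distOf p (fun ω => (K ω, X ω, Q ω)) (k, xq)
        - distOf p (fun ω => (K ω, X ω, Q ω)) (k', xq)|
      ≤ ∑ q, |distOf p (fun ω => (K ω, Q ω)) (k, q) - distOf p (fun ω => (K ω, Q ω)) (k', q)| := by
  rw [Fintype.sum_prod_type_right]
  refine Finset.sum_le_sum fun q _ => ?_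
  rcases (distOf_nonneg hp Q q).eq_or_lt with hq | hq
  · have hzero : ∀ l x, distOf p (fun ω => (K ω, X ω, Q ω)) (l, x, q) = 0 := fun l x => by
      refine le_antisymm ?_ (distOf_nonneg hp _ _)
      rw [hq]
      refine Finset.sum_le_sum fun ω _ => ?_
      by_cases h : Q ω = q <;> simp only [Prod.mk.injEq, h, and_true, and_false, if_true, if_false]
      · split_ifs <;> simp [hp ω]
      · exact le_rfl
    simp [hzero]
  · have heq : ∀ x, |distOf p (fun ω => (K ω, X ω, Q ω)) (k, x, q)
        - distOf p (fun ω => (K ω, X ω, Q ω)) (k', x, q)| * distOf p Q q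
        = |distOf p (fun ω => (K ω, Q ω)) (k, q) - distOf p (fun ω => (K ω, Q ω)) (k', q)|
          * distOf p (fun ω => (X ω, Q ω)) (x, q) := fun x => by
      have hn := distOf_nonneg hp (fun ω => (X ω, Q ω)) (x, q)
      have h := congrArg abs (congrArg₂ (· - ·) (hMarkov k q x) (hMarkov k' q x))
      simpa only [← sub_mul, abs_mul, abs_of_pos hq, abs_of_nonneg hn] using h
    refine le_of_mul_le_mul_right (le_of_eq ?_) hq
    rw [Finset.sum_mul, Finset.sum_congr rfl fun x _ => heq x, ← Finset.mul_sum,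
      sum_distOf_prod_left]

/-!
STATEMENT 15: If `K` is uniform on `[f]` (`f ≥ 2`), `K → Q → X` is a Markov chain, and
`I(K;Q) ≤ γ`, then for all `k, k'` the total variation distance between the conditional
joint distributions of `(X,Q)` given `K = k` and given `K = k'` is at most `√(2γf)`.
-/

theorem spir_markov_total_variation_bound
    (f : ℕ) (hf : 2 ≤ f)
    (Ω : Type*) [Fintype Ω] (p : Ω → ℝ) (hp : IsPMF p)
    (𝒬 𝒳 : Type*) [Fintype 𝒬] [Fintype 𝒳]
    (K : Ω → Fin f) (Q : Ω → 𝒬) (X : Ω → 𝒳)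
    -- `K` is uniformly distributed on `[f]`:
    (hK : ∀ k, distOf p K k = ((f : ℝ))⁻¹)
    -- Markov chain `K → Q → X`: `X` and `K` are conditionally independent given `Q`:
    (hMarkov : ∀ (k : Fin f) (q : 𝒬) (xv : 𝒳),
      distOf p (fun ω => (K ω, X ω, Q ω)) (k, xv, q) * distOf p Q q
        = distOf p (fun ω => (K ω, Q ω)) (k, q)
          * distOf p (fun ω => (X ω, Q ω)) (xv, q))
    (γ : ℝ) (hγ : mutualInfo p K Q ≤ γ) :
    ∀ k k' : Fin f,
      (1 / 2) * ∑ xq : 𝒳 × 𝒬,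
          |condProb p (fun ω => (X ω, Q ω) = xq) (fun ω => K ω = k)
            - condProb p (fun ω => (X ω, Q ω) = xq) (fun ω => K ω = k')|
        ≤ Real.sqrt (2 * γ * (f : ℝ)) := by
  intro k k'
  rcases eq_or_ne k k' with rfl | hne
  · simpa using Real.sqrt_nonneg (2 * γ * f)
  have hf0 : (0 : ℝ) < f := by exact_mod_cast (by omega : 0 < f)
  have hMarkov_le := sum_abs_sub_le_of_markov hp.1 K Q X hMarkov k k'
  have hHell := (sum_sq_sqrt_sub_sqrt_le_mutualInfo hp K Q).trans hγ
  simp only [hK] at hHell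
  set A : Fin f → ℝ := fun l =>
    ∑ q, (√(distOf p (fun ω => (K ω, Q ω)) (l, q)) - √((f : ℝ)⁻¹ * distOf p Q q)) ^ 2 with hA
  have hA0 : ∀ l, 0 ≤ A l := fun l => Finset.sum_nonneg fun _ _ => sq_nonneg _
  have hpair : A k + A k' ≤ γ := by
    refine le_trans ?_ hHell
    rw [← Finset.sum_pair hne]
    exact Finset.sum_le_sum_of_subset_of_nonneg (Finset.subset_univ _) fun l _ _ => hA0 l
  set T : Fin f → ℝ := fun l =>
    ∑ q, |distOf p (fun ω => (K ω, Q ω)) (l, q) - (f : ℝ)⁻¹ * distOf p Q q| with hT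
  have hTA : ∀ l, T l ^ 2 ≤ 4 * (f : ℝ)⁻¹ * A l := fun l => by
    have h := sq_sum_abs_sub_le_hellinger
      (u := fun q => distOf p (fun ω => (K ω, Q ω)) (l, q))
      (v := fun q => (f : ℝ)⁻¹ * distOf p Q q) (fun _ => distOf_nonneg hp.1 _ _)
      (fun _ => mul_nonneg (inv_nonneg.2 hf0.le) (distOf_nonneg hp.1 _ _))
    rw [sum_distOf_prod_right, hK, ← Finset.mul_sum, sum_distOf, hp.2] at h
    refine h.trans_eq ?_
    simp only [hA]
    ring
  have htri : ∑ q, |distOf p (fun ω => (K ω, Q ω)) (k, q)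
      - distOf p (fun ω => (K ω, Q ω)) (k', q)| ≤ T k + T k' := by
    simp only [hT]
    rw [← Finset.sum_add_distrib]
    refine Finset.sum_le_sum fun q _ => ?_
    rw [abs_sub_comm (distOf p (fun ω => (K ω, Q ω)) (k', q))]
    exact abs_sub_le _ _ _
  have hsum : ∑ xq : 𝒳 × 𝒬,
      |condProb p (fun ω => (X ω, Q ω) = xq) (fun ω => K ω = k)
        - condProb p (fun ω => (X ω, Q ω) = xq) (fun ω => K ω = k')| ≤ f * (T k + T k') := by
    refine le_trans (le_of_eq ?_) (mul_le_mul_of_nonneg_left (hMarkov_le.trans htri) hf0.le)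
    rw [Finset.mul_sum]
    refine Finset.sum_congr rfl fun xq _ => ?_
    rw [condProb_eq_distOf_div p (fun ω => (X ω, Q ω)) K, hK,
      condProb_eq_distOf_div p (fun ω => (X ω, Q ω)) K, hK, div_inv_eq_mul, div_inv_eq_mul,
      ← sub_mul, abs_mul, abs_of_pos hf0, mul_comm]
  refine (mul_le_mul_of_nonneg_left hsum (by norm_num)).trans (Real.le_sqrt_of_sq_le ?_)
  have hsq : (T k + T k') ^ 2 ≤ 8 * (f : ℝ)⁻¹ * γ := by
    have h := mul_le_mul_of_nonneg_left hpair (inv_nonneg.2 hf0.le)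
    linarith [hTA k, hTA k', add_sq_le (a := T k) (b := T k')]
  calc (1 / 2 * (f * (T k + T k'))) ^ 2 = f ^ 2 / 4 * (T k + T k') ^ 2 := by ring
    _ ≤ f ^ 2 / 4 * (8 * (f : ℝ)⁻¹ * γ) := mul_le_mul_of_nonneg_left hsq (by positivity)
    _ = 2 * γ * f := by field_simp; ring
end
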